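/- arXiv:2404.17386 — 6 statements merged into one kernel-verified Lean document; each statement's English description precedes it below -/
import Mathlib

section
/- Let n ≥ 1, let R : ℝⁿ → ℝ be continuous, and let φ : ℝⁿ → ℝ be a differentiable, strictly convex function such that ‖∇φ(x_k)‖ → ∞ whenever ‖x_k‖ → ∞, and such that for every α > 0 the function x ↦ αR(x) + φ(x) is supercoercive. Then for every x ∈ ℝⁿ, the set of minimizers argmin_{u ∈ ℝⁿ} { R(u) + D_φ(u, x) } is a nonempty compact subset of ℝⁿ. -/
open Filter Topology Metric

/-- The Bregman distance generated by a differentiable function `φ`: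
`D_φ(u, x) = φ(u) − φ(x) − ⟨∇φ(x), u − x⟩`. -/
noncomputable def bregman {n : ℕ} (φ : EuclideanSpace ℝ (Fin n) → ℝ)
    (u x : EuclideanSpace ℝ (Fin n)) : ℝ :=
  φ u - φ x - (inner ℝ (gradient φ x) (u - x) : ℝ)

/-- A continuous real function tending to `+∞` at infinity on a nonempty proper metric space has
a nonempty compact set of global minimizers. -/
theorem argmin_nonempty_isCompact_of_tendsto_cobounded {E : Type*} [PseudoMetricSpace E]
    [ProperSpace E] [Nonempty E] {f : E → ℝ} (hf : Continuous f)
    (hlim : Tendsto f (Bornology.cobounded E) atTop) :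
    {u | ∀ v, f u ≤ f v}.Nonempty ∧ IsCompact {u | ∀ v, f u ≤ f v} := by
  refine ⟨hf.exists_forall_le (by rwa [← cobounded_eq_cocompact]), ?_⟩
  obtain ⟨a⟩ := ‹Nonempty E›
  refine isCompact_of_isClosed_isBounded ?_ ?_
  · simp only [Set.ofPred_forall]
    exact isClosed_iInter fun v => isClosed_le hf continuous_const
  · have hbdd : Bornology.IsBounded {u | f a < f u}ᶜ :=
      Bornology.isBounded_compl_iff.2 (hlim.eventually_gt_atTop (f a))
    exact hbdd.subset fun u hu => not_lt.2 (hu a)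

/-- A supercoercive function minus a continuous linear functional tends to `+∞` at infinity. -/
theorem tendsto_sub_inner_cobounded_of_supercoercive {E : Type*} [NormedAddCommGroup E]
    [InnerProductSpace ℝ E] {h : E → ℝ}
    (hh : Tendsto (fun u => h u / ‖u‖) (Bornology.cobounded E) atTop) (g : E) :
    Tendsto (fun u => h u - inner ℝ g u) (Bornology.cobounded E) atTop := by
  refine tendsto_atTop_mono' _ ?_ tendsto_norm_cobounded_atTop
  filter_upwards [hh.eventually_ge_atTop (‖g‖ + 1),
    tendsto_norm_cobounded_atTop.eventually_gt_atTop 0] with u hu hpos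
  rw [le_div_iff₀ hpos] at hu
  linarith [real_inner_le_norm g u]

/-- Let `R` be continuous and `φ` a differentiable, strictly convex
function such that `‖∇φ(x_k)‖ → ∞` whenever `‖x_k‖ → ∞`, and such that `α R + φ` is
supercoercive for every `α > 0`.  Then for every `x`, the set of minimizers of
`u ↦ R(u) + D_φ(u, x)` is a nonempty compact subset of `ℝⁿ`. -/
theorem stmt0 (n : ℕ) (hn : 1 ≤ n)
    (R φ : EuclideanSpace ℝ (Fin n) → ℝ)
    (hR : Continuous R)
    (hφdiff : Differentiable ℝ φ)
    (hφconv : StrictConvexOn ℝ Set.univ φ)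
    (hgrad : ∀ x : ℕ → EuclideanSpace ℝ (Fin n),
      Tendsto (fun k => ‖x k‖) atTop atTop →
      Tendsto (fun k => ‖gradient φ (x k)‖) atTop atTop)
    (hsc : ∀ α : ℝ, 0 < α →
      Tendsto (fun u => (α * R u + φ u) / ‖u‖) (Bornology.cobounded _) atTop) :
    ∀ x : EuclideanSpace ℝ (Fin n),
      {u : EuclideanSpace ℝ (Fin n) |
          ∀ v, R u + bregman φ u x ≤ R v + bregman φ v x}.Nonempty ∧
      IsCompact {u : EuclideanSpace ℝ (Fin n) |
          ∀ v, R u + bregman φ u x ≤ R v + bregman φ v x} := by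
  intro x
  have hφ : Continuous φ := hφdiff.continuous
  refine argmin_nonempty_isCompact_of_tendsto_cobounded
    (f := fun u => R u + bregman φ u x) (by unfold bregman; fun_prop) ?_
  have hlim := tendsto_sub_inner_cobounded_of_supercoercive (hsc 1 one_pos) (gradient φ x)
  refine (tendsto_atTop_add_const_right _ (inner ℝ (gradient φ x) x - φ x) hlim).congr fun u => ?_
  rw [bregman, inner_sub_right]
  ring
end

section
/- Let n ≥ 1 and let D : ℝⁿ ⇉ ℝⁿ be a set-valued mapping with closed graph whose values are nonempty, closed and convex. Let {x_k} and {d_k} be bounded sequences in ℝⁿ with d_k ∈ D^{δ_k}(x_k) for nonnegative reals δ_k → 0, and let {d^e_k} ⊂ ℝⁿ satisfy ‖d^e_k‖ ≤ ν_k with ν_k → 0. Then for every strictly increasing sequence of indices {k_j} such that x_{k_j} → x̄, it holds that lim_{N→∞} dist( (1/N) ∑_{j=1}^{N} (d_{k_j} + d^e_{k_j}) , D(x̄) ) = 0. -/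
open Filter Topology Metric
open scoped Pointwise

/-- The `δ`-perturbed set `F^δ(x) = ⋃_{‖y−x‖ ≤ δ} (F(y) + δ𝔹)`. -/
def pert {E : Type*} [NormedAddCommGroup E] (F : E → Set E) (δ : ℝ) (x : E) : Set E :=
  ⋃ y ∈ Metric.closedBall x δ, (F y + Metric.closedBall (0 : E) δ)

/-- The distance to a nonempty convex set is a convex function. -/
theorem Convex.convexOn_infDist {E : Type*} [NormedAddCommGroup E] [NormedSpace ℝ E]
    {s : Set E} (hs : Convex ℝ s) (hne : s.Nonempty) :
    ConvexOn ℝ Set.univ fun w => infDist w s := by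
  refine ⟨convex_univ, fun u _ w _ a b ha hb hab => le_of_forall_pos_le_add fun ε hε => ?_⟩
  obtain ⟨p, hp, hup⟩ := (infDist_lt_iff hne).1 (lt_add_of_pos_right (infDist u s) hε)
  obtain ⟨q, hq, hwq⟩ := (infDist_lt_iff hne).1 (lt_add_of_pos_right (infDist w s) hε)
  calc infDist (a • u + b • w) s
      ≤ dist (a • u + b • w) (a • p + b • q) := infDist_le_dist_of_mem (hs hp hq ha hb hab)
    _ ≤ dist (a • u) (a • p) + dist (b • w) (b • q) := dist_add_add_le _ _ _ _
    _ = a * dist u p + b * dist w q := by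
        rw [dist_smul₀, dist_smul₀, Real.norm_of_nonneg ha, Real.norm_of_nonneg hb]
    _ ≤ a * (infDist u s + ε) + b * (infDist w s + ε) := by gcongr
    _ = a • infDist u s + b • infDist w s + (a + b) * ε := by simp only [smul_eq_mul]; ring
    _ = a • infDist u s + b • infDist w s + ε := by rw [hab, one_mul]

/-- If the distances of `u j` to a nonempty convex set tend to zero, so do those of the
Cesàro averages of `u`. -/
theorem Convex.tendsto_infDist_cesaro {E : Type*} [NormedAddCommGroup E] [NormedSpace ℝ E]
    {s : Set E} (hs : Convex ℝ s) (hne : s.Nonempty) {u : ℕ → E}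
    (hu : Tendsto (fun j => infDist (u j) s) atTop (𝓝 0)) :
    Tendsto (fun N : ℕ => infDist ((N : ℝ)⁻¹ • ∑ j ∈ Finset.range N, u j) s) atTop (𝓝 0) := by
  refine squeeze_zero' (Eventually.of_forall fun _ => infDist_nonneg) ?_ hu.cesaro
  filter_upwards [eventually_gt_atTop 0] with N hN
  have hN' : (N : ℝ) ≠ 0 := Nat.cast_ne_zero.2 hN.ne'
  have h := (hs.convexOn_infDist hne).map_sum_le (t := Finset.range N)
    (w := fun _ => (N : ℝ)⁻¹) (p := u) (fun _ _ => by positivity)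
    (by simp [hN']) (fun _ _ => Set.mem_univ _)
  simpa only [← Finset.smul_sum, smul_eq_mul, ← Finset.mul_sum] using h

/-- Bounded selections from vanishing perturbations of a closed-graph mapping along a
convergent sequence approach the value at the limit. -/
theorem tendsto_infDist_of_mem_pert {E : Type*} [NormedAddCommGroup E] [ProperSpace E]
    {D : E → Set E} (hgraph : IsClosed {p : E × E | p.2 ∈ D p.1})
    {x d : ℕ → E} {δ : ℕ → ℝ} {a : E} (hd : Bornology.IsBounded (Set.range d))
    (hδ : Tendsto δ atTop (𝓝 0)) (hmem : ∀ k, d k ∈ pert D (δ k) (x k))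
    (hx : Tendsto x atTop (𝓝 a)) :
    Tendsto (fun j => infDist (d j) (D a)) atTop (𝓝 0) := by
  have hsel : ∀ k, ∃ y v, dist y (x k) ≤ δ k ∧ v ∈ D y ∧ dist v (d k) ≤ δ k := by
    intro k
    obtain ⟨y, hy, v, hv, e, he, hve⟩ : ∃ y, y ∈ closedBall (x k) (δ k) ∧
        ∃ v ∈ D y, ∃ e ∈ closedBall (0 : E) (δ k), v + e = d k := by
      simpa only [pert, Set.mem_iUnion₂, Set.mem_add, exists_prop] using hmem k
    refine ⟨y, v, hy, hv, ?_⟩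
    rw [← hve, dist_self_add_right]
    exact mem_closedBall_zero_iff.1 he
  choose y v hy hv hvd using hsel
  have hya : Tendsto y atTop (𝓝 a) :=
    (tendsto_iff_of_dist (squeeze_zero (fun _ => dist_nonneg) hy hδ)).2 hx
  refine tendsto_of_subseq_tendsto fun ns hns => ?_
  obtain ⟨b, -, φ, hφ, hb⟩ := tendsto_subseq_of_bounded hd (x := d ∘ ns) fun k => ⟨ns k, rfl⟩
  have hsub : Tendsto (ns ∘ φ) atTop atTop := hns.comp hφ.tendsto_atTop
  have hvb : Tendsto (v ∘ ns ∘ φ) atTop (𝓝 b) :=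
    (tendsto_iff_of_dist
      ((squeeze_zero (fun _ => dist_nonneg) hvd hδ).comp hsub)).2 hb
  have hbD : b ∈ D a := hgraph.mem_of_tendsto ((hya.comp hsub).prodMk_nhds hvb)
    (Eventually.of_forall fun k => hv _)
  refine ⟨φ, ?_⟩
  have h := ((continuous_infDist_pt (D a)).tendsto b).comp hb
  rwa [infDist_zero_of_mem hbD] at h

/-- For a closed-graph, nonempty-closed-convex-valued mapping `D`,
bounded sequences `x_k`, `d_k` with `d_k ∈ D^{δ_k}(x_k)`, `δ_k → 0`, and errors
`‖d^e_k‖ ≤ ν_k → 0`: along any subsequence `x_{k_j} → x̄`, the Cesàro averages of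
`d_{k_j} + d^e_{k_j}` approach `D(x̄)` in distance. -/
theorem stmt3 (n : ℕ) (hn : 1 ≤ n)
    (D : EuclideanSpace ℝ (Fin n) → Set (EuclideanSpace ℝ (Fin n)))
    (hgraph : IsClosed {p : EuclideanSpace ℝ (Fin n) × EuclideanSpace ℝ (Fin n) |
        p.2 ∈ D p.1})
    (hne : ∀ x, (D x).Nonempty) (hcl : ∀ x, IsClosed (D x)) (hcv : ∀ x, Convex ℝ (D x))
    (x d de : ℕ → EuclideanSpace ℝ (Fin n)) (δ ν : ℕ → ℝ)
    (hxbd : Bornology.IsBounded (Set.range x))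
    (hdbd : Bornology.IsBounded (Set.range d))
    (hδnn : ∀ k, 0 ≤ δ k) (hδ : Tendsto δ atTop (nhds 0))
    (hdk : ∀ k, d k ∈ pert D (δ k) (x k))
    (hde : ∀ k, ‖de k‖ ≤ ν k) (hν : Tendsto ν atTop (nhds 0))
    (ks : ℕ → ℕ) (hks : StrictMono ks) (xbar : EuclideanSpace ℝ (Fin n))
    (hconv : Tendsto (fun j => x (ks j)) atTop (nhds xbar)) :
    Tendsto (fun N : ℕ =>
        Metric.infDist ((N : ℝ)⁻¹ • ∑ j ∈ Finset.range N, (d (ks j) + de (ks j)))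
          (D xbar)) atTop (nhds 0) := by
  have hd : Tendsto (fun j => infDist (d (ks j)) (D xbar)) atTop (𝓝 0) :=
    tendsto_infDist_of_mem_pert hgraph (hdbd.subset (Set.range_comp_subset_range ks d))
      (hδ.comp hks.tendsto_atTop) (fun j => hdk (ks j)) hconv
  refine (hcv xbar).tendsto_infDist_cesaro (hne xbar) ?_
  refine squeeze_zero (fun _ => infDist_nonneg) (fun j => ?_)
    (by simpa only [add_zero] using hd.add (hν.comp hks.tendsto_atTop))
  refine infDist_le_infDist_add_dist.trans (add_le_add_right ?_ _)
  rw [dist_self_add_left]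
  exact hde (ks j)
end

section
/- Let n ≥ 1, let φ : ℝⁿ → ℝ be twice continuously differentiable with ∇²φ(x) positive definite for every x ∈ ℝⁿ, and let D : ℝⁿ ⇉ ℝⁿ be a set-valued mapping with closed graph whose values are nonempty, compact and convex. Let {x_k}, {m_k}, {d_k} be bounded sequences in ℝⁿ with d_k ∈ D^{δ_k}(x_k) for nonnegative reals δ_k → 0; let {d^e_k} ⊂ ℝⁿ satisfy ‖d^e_k‖ ≤ ν_k with ν_k → 0; and let η_k, θ_k > 0 satisfy θ_k/η_k → τ for some τ > 0. Define d_{x,k} = m_k + d^e_k, d_{m,k} = (θ_k/η_k)(∇²φ(x_k))⁻¹(m_k − d_k), and H(x, m) = {(m, τ(∇²φ(x))⁻¹(m − v)) : v ∈ D(x)} ⊆ ℝⁿ × ℝⁿ. Then for every strictly increasing sequence of indices {k_j} such that (x_{k_j}, m_{k_j}) → (x̄, m̄), it holds that lim_{N→∞} dist( (1/N) ∑_{j=1}^{N} (d_{x,k_j}, d_{m,k_j}) , H(x̄, m̄) ) = 0. -/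
open Filter Topology Metric
open scoped Pointwise

/-- The Hessian of `φ` at `x`, viewed as a continuous linear map (the Fréchet derivative
of the gradient map). -/
noncomputable def hess {n : ℕ} (φ : EuclideanSpace ℝ (Fin n) → ℝ)
    (x : EuclideanSpace ℝ (Fin n)) :
    EuclideanSpace ℝ (Fin n) →L[ℝ] EuclideanSpace ℝ (Fin n) :=
  fderiv ℝ (gradient φ) x

/-- Cesàro averages of a sequence asymptotic to points of a convex set approach that set. -/
theorem tendsto_infDist_cesaro_of_convex {E : Type*} [NormedAddCommGroup E] [NormedSpace ℝ E]
    {H : Set E} (hH : Convex ℝ H) {u w : ℕ → E} (hw : ∀ j, w j ∈ H)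
    (huw : Tendsto (fun j => u j - w j) atTop (nhds 0)) :
    Tendsto (fun N : ℕ => infDist ((N : ℝ)⁻¹ • ∑ j ∈ Finset.range N, u j) H)
      atTop (nhds 0) := by
  have hces := huw.cesaro_smul.norm
  rw [norm_zero] at hces
  refine squeeze_zero' (Eventually.of_forall fun _ => infDist_nonneg) ?_ hces
  filter_upwards [eventually_gt_atTop 0] with N hN
  have hN' : (0 : ℝ) < N := Nat.cast_pos.2 hN
  have hmem : (N : ℝ)⁻¹ • ∑ j ∈ Finset.range N, w j ∈ H := by
    rw [Finset.smul_sum]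
    refine hH.sum_mem (fun _ _ => by positivity) ?_ fun j _ => hw j
    simp [hN'.ne']
  refine (infDist_le_dist_of_mem hmem).trans_eq ?_
  rw [dist_eq_norm, ← smul_sub, ← Finset.sum_sub_distrib]

/-- Bounded selections of a closed-graph mapping along `y j → a` approach the value at `a`. -/
theorem tendsto_infDist_of_isClosed_graph {E F : Type*} [PseudoMetricSpace E]
    [PseudoMetricSpace F] [ProperSpace F] {D : E → Set F}
    (hgraph : IsClosed {p : E × F | p.2 ∈ D p.1}) {y : ℕ → E} {v : ℕ → F} {a : E}
    (hy : Tendsto y atTop (nhds a)) (hv : Bornology.IsBounded (Set.range v))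
    (hmem : ∀ j, v j ∈ D (y j)) :
    Tendsto (fun j => infDist (v j) (D a)) atTop (nhds 0) := by
  refine tendsto_of_subseq_tendsto fun ns hns => ?_
  obtain ⟨b, -, ms, hms, hb⟩ := tendsto_subseq_of_bounded hv (x := v ∘ ns)
    fun j => Set.mem_range_self (ns j)
  refine ⟨ms, ?_⟩
  have hbD : b ∈ D a :=
    hgraph.mem_of_tendsto ((hy.comp (hns.comp hms.tendsto_atTop)).prodMk_nhds hb)
      (Eventually.of_forall fun j => hmem _)
  rw [← infDist_zero_of_mem hbD]
  exact ((continuous_infDist_pt (D a)).tendsto b).comp hb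

/-- The Hessian of a twice continuously differentiable function is continuous. -/
theorem continuous_hess {n : ℕ} {φ : EuclideanSpace ℝ (Fin n) → ℝ} (hφ : ContDiff ℝ 2 φ) :
    Continuous (hess φ) := by
  have hgrad : ContDiff ℝ 1 (gradient φ) :=
    (InnerProductSpace.toDual ℝ
      (EuclideanSpace ℝ (Fin n))).symm.toContinuousLinearEquiv.contDiff.comp
      (hφ.fderiv_right (m := 1) (by norm_num))
  exact hgrad.continuous_fderiv (by norm_num)

/-- In finite dimension, inversion is continuous at every injective endomorphism. -/
theorem continuousAt_inverse_of_injective {E : Type*} [NormedAddCommGroup E] [NormedSpace ℝ E]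
    [FiniteDimensional ℝ E] {A : E →L[ℝ] E} (hA : Function.Injective A) :
    ContinuousAt (ContinuousLinearMap.inverse : (E →L[ℝ] E) → (E →L[ℝ] E)) A := by
  have : CompleteSpace E := FiniteDimensional.complete ℝ E
  let e : E ≃L[ℝ] E :=
    (LinearEquiv.ofInjectiveEndo (A : E →ₗ[ℝ] E) hA).toContinuousLinearEquiv
  have he : (e : E →L[ℝ] E) = A := by ext v; rfl
  rw [← he]
  exact (contDiffAt_map_inverse (n := 0) (𝕜 := ℝ) e).continuousAt

/-- A point of the perturbed set is within `δ` of a value of `F` at a point within `δ`. -/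
theorem exists_mem_of_mem_pert {E : Type*} [NormedAddCommGroup E] {F : E → Set E} {δ : ℝ}
    {x z : E} (hz : z ∈ pert F δ x) : ∃ y v, v ∈ F y ∧ dist y x ≤ δ ∧ ‖z - v‖ ≤ δ := by
  simp only [pert, Set.mem_iUnion, Set.mem_add] at hz
  obtain ⟨y, hy, v, hv, e, he, rfl⟩ := hz
  exact ⟨y, v, hv, hy, by simpa using he⟩

/-- Bounded sequences in the vanishing perturbations `D^{δ j}(x j)`, with `x j → a` and
closed-graph `D` with nonempty compact values, are asymptotic to a sequence in `D a`. -/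
theorem exists_tendsto_sub_of_mem_pert {E : Type*} [NormedAddCommGroup E] [ProperSpace E]
    {D : E → Set E} (hgraph : IsClosed {p : E × E | p.2 ∈ D p.1}) {x d : ℕ → E} {δ : ℕ → ℝ}
    {a : E} (hne : (D a).Nonempty) (hcp : IsCompact (D a)) (hx : Tendsto x atTop (nhds a))
    (hd : Bornology.IsBounded (Set.range d)) (hδ : Tendsto δ atTop (nhds 0))
    (hmem : ∀ j, d j ∈ pert D (δ j) (x j)) :
    ∃ w : ℕ → E, (∀ j, w j ∈ D a) ∧ Tendsto (fun j => d j - w j) atTop (nhds 0) := by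
  choose y v hvy hyx hdv using fun j => exists_mem_of_mem_pert (hmem j)
  have hy : Tendsto y atTop (nhds a) :=
    (tendsto_iff_of_dist (squeeze_zero (fun _ => dist_nonneg) hyx hδ)).2 hx
  have hdv0 : Tendsto (fun j => d j - v j) atTop (nhds 0) := squeeze_zero_norm hdv hδ
  have hv : Bornology.IsBounded (Set.range v) := by
    refine (hd.sub (isBounded_range_of_tendsto _ hdv0)).subset ?_
    rintro _ ⟨j, rfl⟩
    exact ⟨d j, ⟨j, rfl⟩, d j - v j, ⟨j, rfl⟩, sub_sub_cancel _ _⟩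
  choose w hw hdist using fun j => hcp.exists_infDist_eq_dist hne (v j)
  refine ⟨w, hw, ?_⟩
  have hvw : Tendsto (fun j => v j - w j) atTop (nhds 0) := by
    rw [tendsto_zero_iff_norm_tendsto_zero]
    simpa only [hdist, dist_eq_norm] using tendsto_infDist_of_isClosed_graph hgraph hy hv hvy
  simpa using hdv0.add hvw

/-- Momentum/preconditioned directions: along a subsequence with
`(x_{k_j}, m_{k_j}) → (x̄, m̄)`, the Cesàro averages of
`(m_{k_j} + d^e_{k_j}, (θ_{k_j}/η_{k_j}) (∇²φ(x_{k_j}))⁻¹ (m_{k_j} − d_{k_j}))`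
approach the set `H(x̄, m̄) = {(m̄, τ (∇²φ(x̄))⁻¹ (m̄ − v)) : v ∈ D(x̄)}` in distance. -/
theorem stmt4 (n : ℕ) (hn : 1 ≤ n)
    (φ : EuclideanSpace ℝ (Fin n) → ℝ) (hφ : ContDiff ℝ 2 φ)
    (hpos : ∀ x v : EuclideanSpace ℝ (Fin n), v ≠ 0 → 0 < (inner ℝ v (hess φ x v) : ℝ))
    (D : EuclideanSpace ℝ (Fin n) → Set (EuclideanSpace ℝ (Fin n)))
    (hgraph : IsClosed {p : EuclideanSpace ℝ (Fin n) × EuclideanSpace ℝ (Fin n) |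
        p.2 ∈ D p.1})
    (hne : ∀ x, (D x).Nonempty) (hcp : ∀ x, IsCompact (D x)) (hcv : ∀ x, Convex ℝ (D x))
    (x m d de : ℕ → EuclideanSpace ℝ (Fin n)) (δ ν η θ : ℕ → ℝ) (τ : ℝ) (hτ : 0 < τ)
    (hxbd : Bornology.IsBounded (Set.range x))
    (hmbd : Bornology.IsBounded (Set.range m))
    (hdbd : Bornology.IsBounded (Set.range d))
    (hδnn : ∀ k, 0 ≤ δ k) (hδ : Tendsto δ atTop (nhds 0))
    (hdk : ∀ k, d k ∈ pert D (δ k) (x k))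
    (hde : ∀ k, ‖de k‖ ≤ ν k) (hν : Tendsto ν atTop (nhds 0))
    (hη : ∀ k, 0 < η k) (hθ : ∀ k, 0 < θ k)
    (hratio : Tendsto (fun k => θ k / η k) atTop (nhds τ))
    (ks : ℕ → ℕ) (hks : StrictMono ks)
    (xbar mbar : EuclideanSpace ℝ (Fin n))
    (hconv : Tendsto (fun j => (x (ks j), m (ks j))) atTop (nhds (xbar, mbar))) :
    Tendsto (fun N : ℕ =>
        Metric.infDist
          ((N : ℝ)⁻¹ • ∑ j ∈ Finset.range N,
            ((m (ks j) + de (ks j),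
              (θ (ks j) / η (ks j)) • (hess φ (x (ks j))).inverse (m (ks j) - d (ks j))) :
              EuclideanSpace ℝ (Fin n) × EuclideanSpace ℝ (Fin n)))
          {p : EuclideanSpace ℝ (Fin n) × EuclideanSpace ℝ (Fin n) |
            ∃ v ∈ D xbar, p = (mbar, τ • (hess φ xbar).inverse (mbar - v))})
        atTop (nhds 0) := by
  have hksT := hks.tendsto_atTop
  have hx : Tendsto (fun j => x (ks j)) atTop (nhds xbar) := hconv.fst_nhds
  have hm : Tendsto (fun j => m (ks j)) atTop (nhds mbar) := hconv.snd_nhds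
  have hde0 : Tendsto (fun j => de (ks j)) atTop (nhds 0) :=
    (squeeze_zero_norm hde hν).comp hksT
  obtain ⟨w, hw, hdw⟩ := exists_tendsto_sub_of_mem_pert hgraph (hne xbar) (hcp xbar) hx
    (hdbd.subset (Set.range_comp_subset_range ks d)) (hδ.comp hksT) fun j => hdk (ks j)
  simp only [Function.comp_apply] at hdw
  have hinj : Function.Injective (hess φ xbar) := by
    refine (injective_iff_map_eq_zero _).2 fun v hv => ?_
    by_contra hv0
    simpa [hv] using hpos xbar v hv0
  set A : EuclideanSpace ℝ (Fin n) →L[ℝ] EuclideanSpace ℝ (Fin n) :=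
    (hess φ xbar).inverse
  have hinv : Tendsto (fun j => (hess φ (x (ks j))).inverse) atTop (nhds A) :=
    (continuousAt_inverse_of_injective hinj).tendsto.comp
      (((continuous_hess hφ).tendsto xbar).comp hx)
  have hop : Tendsto (fun j => (θ (ks j) / η (ks j)) • (hess φ (x (ks j))).inverse - τ • A)
      atTop (nhds 0) := by
    simpa using ((hratio.comp hksT).smul hinv).sub_const (τ • A)
  obtain ⟨C, hC⟩ := (hmbd.sub hdbd).exists_norm_le
  have hmd : ∀ k, ‖m k - d k‖ ≤ C := fun k =>
    hC _ (Set.sub_mem_sub (Set.mem_range_self k) (Set.mem_range_self k))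
  have hfst : Tendsto (fun j => m (ks j) + de (ks j) - mbar) atTop (nhds 0) := by
    simpa using (hm.add hde0).sub_const mbar
  have hdiff : Tendsto (fun j => ((θ (ks j) / η (ks j)) • (hess φ (x (ks j))).inverse - τ • A)
      (m (ks j) - d (ks j))) atTop (nhds 0) := by
    refine squeeze_zero_norm (fun j => (ContinuousLinearMap.le_opNorm _ _).trans
      (mul_le_mul_of_nonneg_left (hmd (ks j)) (norm_nonneg _))) ?_
    simpa using hop.norm.mul_const C
  have hlin : Tendsto (fun j => (τ • A) ((m (ks j) - mbar) - (d (ks j) - w j)))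
      atTop (nhds 0) := by
    have hz : Tendsto (fun j => (m (ks j) - mbar) - (d (ks j) - w j)) atTop (nhds 0) := by
      simpa using (hm.sub_const mbar).sub hdw
    have hcont := (τ • A).continuous.tendsto 0
    rw [map_zero] at hcont
    exact hcont.comp hz
  have hconvex : Convex ℝ {p : EuclideanSpace ℝ (Fin n) × EuclideanSpace ℝ (Fin n) |
      ∃ v ∈ D xbar, p = (mbar, τ • A (mbar - v))} := by
    rintro _ ⟨v, hv, rfl⟩ _ ⟨v', hv', rfl⟩ a b ha hb hab
    refine ⟨a • v + b • v', hcv xbar hv hv' ha hb hab, ?_⟩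
    have hmb : a • mbar + b • mbar = mbar := by rw [← add_smul, hab, one_smul]
    have hsplit : mbar - (a • v + b • v') = a • (mbar - v) + b • (mbar - v') := by
      conv_lhs => rw [← hmb]
      module
    rw [hsplit, map_add, map_smul, map_smul, Prod.smul_mk, Prod.smul_mk, Prod.mk_add_mk, hmb]
    congr 1
    module
  refine tendsto_infDist_cesaro_of_convex hconvex
    (w := fun j => (mbar, τ • A (mbar - w j))) (fun j => ⟨w j, hw j, rfl⟩) ?_
  refine (hfst.prodMk_nhds ?_ : Tendsto _ _ (nhds ((0 : EuclideanSpace ℝ (Fin n)),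
    (0 : EuclideanSpace ℝ (Fin n)))))
  rw [← add_zero (0 : EuclideanSpace ℝ (Fin n))]
  refine (hdiff.add hlin).congr fun j => ?_
  simp only [sub_apply, smul_apply, map_sub]
  module
end

section
/- Let n ≥ 1, let f : ℝⁿ → ℝ, let D : ℝⁿ ⇉ ℝⁿ be a set-valued mapping with nonempty values, and let φ : ℝⁿ → ℝ be differentiable. Let z : [0, ∞) → ℝⁿ be locally Lipschitz and suppose: (i) for almost every t ≥ 0, z is differentiable at t, the Hessian ∇²φ(z(t)) exists and is positive definite, and ∇²φ(z(t)) ż(t) ∈ −D(z(t)); (ii) for almost every t ≥ 0, the function s ↦ f(z(s)) is differentiable at t and its derivative equals ⟨v, ż(t)⟩ for every v ∈ D(z(t)); (iii) for all 0 ≤ t₁ ≤ t₂, f(z(t₂)) − f(z(t₁)) = ∫_{t₁}^{t₂} (f∘z)'(s) ds and z(t₂) − z(t₁) = ∫_{t₁}^{t₂} ż(s) ds, where (f∘z)' and ż denote the almost-everywhere derivatives. Then t ↦ f(z(t)) is nonincreasing on [0, ∞), and if 0 ∉ D(z(0)) then there exists T > 0 such that f(z(T)) < f(z(0)). -/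
open Filter Topology Metric MeasureTheory

/-- Descent along a trajectory of the Bregman differential inclusion:
if `z` is locally Lipschitz on `[0,∞)`, with a.e. derivative `z'`, a.e.
`∇²φ(z(t)) ż(t) ∈ −D(z(t))` with `∇²φ(z(t))` positive definite, the chain rule holds
a.e. for `f ∘ z`, and both `f ∘ z` and `z` are integrals of their a.e. derivatives, then
`t ↦ f(z(t))` is nonincreasing on `[0,∞)`, and if `0 ∉ D(z(0))` then `f(z(T)) < f(z(0))`
for some `T > 0`. -/
theorem stmt5 (n : ℕ) (hn : 1 ≤ n)
    (f : EuclideanSpace ℝ (Fin n) → ℝ)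
    (D : EuclideanSpace ℝ (Fin n) → Set (EuclideanSpace ℝ (Fin n)))
    (hne : ∀ x, (D x).Nonempty)
    (φ : EuclideanSpace ℝ (Fin n) → ℝ) (hφ : Differentiable ℝ φ)
    (z : ℝ → EuclideanSpace ℝ (Fin n))
    (hzlip : LocallyLipschitzOn (Set.Ici (0 : ℝ)) z)
    (z' : ℝ → EuclideanSpace ℝ (Fin n)) (fz' : ℝ → ℝ)
    -- (i): a.e. on [0,∞), z is differentiable, the Hessian of φ at z(t) exists and is
    -- positive definite, and ∇²φ(z(t)) ż(t) ∈ −D(z(t)).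
    (hi : ∀ᵐ t ∂(volume.restrict (Set.Ici (0 : ℝ))),
      HasDerivAt z (z' t) t ∧
      ∃ A : EuclideanSpace ℝ (Fin n) →L[ℝ] EuclideanSpace ℝ (Fin n),
        HasFDerivAt (gradient φ) A (z t) ∧
        (∀ v : EuclideanSpace ℝ (Fin n), v ≠ 0 → 0 < (inner ℝ v (A v) : ℝ)) ∧
        A (z' t) ∈ -(D (z t)))
    -- (ii): a.e. on [0,∞), f ∘ z is differentiable with derivative ⟨v, ż(t)⟩ for every
    -- v ∈ D(z(t)).
    (hii : ∀ᵐ t ∂(volume.restrict (Set.Ici (0 : ℝ))),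
      HasDerivAt (fun s => f (z s)) (fz' t) t ∧
      ∀ v ∈ D (z t), fz' t = (inner ℝ v (z' t) : ℝ))
    -- (iii): fundamental theorem of calculus for f ∘ z and z.
    (hiii : ∀ t₁ t₂ : ℝ, 0 ≤ t₁ → t₁ ≤ t₂ →
      (f (z t₂) - f (z t₁) = ∫ s in t₁..t₂, fz' s) ∧
      (z t₂ - z t₁ = ∫ s in t₁..t₂, z' s)) :
    AntitoneOn (fun t => f (z t)) (Set.Ici (0 : ℝ)) ∧
    ((0 : EuclideanSpace ℝ (Fin n)) ∉ D (z 0) →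
      ∃ T : ℝ, 0 < T ∧ f (z T) < f (z 0)) := by
  have key : ∀ᵐ t ∂(volume.restrict (Set.Ici (0 : ℝ))),
      fz' t ≤ 0 ∧ (fz' t = 0 → z' t = 0 ∧ (0 : EuclideanSpace ℝ (Fin n)) ∈ D (z t)) := by
    filter_upwards [hi, hii] with t ⟨_, A, _, hpos, hmem⟩ ⟨_, hchain⟩
    have hval : fz' t = -(inner ℝ (z' t) (A (z' t)) : ℝ) := by
      rw [hchain _ (Set.mem_neg.mp hmem), inner_neg_left, real_inner_comm]
    by_cases hz : z' t = 0
    · have hD : (0 : EuclideanSpace ℝ (Fin n)) ∈ D (z t) := by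
        simpa [hz] using hmem
      exact ⟨by simp [hval, hz], fun _ => ⟨hz, hD⟩⟩
    · have hlt := hpos _ hz
      exact ⟨by linarith, fun h => by linarith⟩
  have hanti : AntitoneOn (fun t => f (z t)) (Set.Ici (0 : ℝ)) := by
    intro a ha b _ hab
    have ha0 : (0 : ℝ) ≤ a := ha
    have hint : ∫ s in a..b, fz' s ≤ 0 := by
      rw [intervalIntegral.integral_of_le hab]
      have hsub : Set.Ioc a b ⊆ Set.Ici (0 : ℝ) := fun s hs => ha0.trans hs.1.le
      apply integral_nonpos_of_ae
      filter_upwards [ae_restrict_of_ae_restrict_of_subset hsub key] with s hs using hs.1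
    have hftc := (hiii a b ha0 hab).1
    show f (z b) ≤ f (z a)
    linarith
  refine ⟨hanti, fun h0 => ?_⟩
  by_contra! hno
  have hconst : ∀ t : ℝ, 0 < t → f (z t) = f (z 0) := fun t ht =>
    le_antisymm (hanti (Set.mem_Ici.mpr le_rfl) (Set.mem_Ici.mpr ht.le) ht.le) (hno t ht)
  have hstat : ∀ᵐ t ∂(volume.restrict (Set.Ioi (0 : ℝ))),
      z' t = 0 ∧ (0 : EuclideanSpace ℝ (Fin n)) ∈ D (z t) := by
    filter_upwards [ae_restrict_of_ae_restrict_of_subset Set.Ioi_subset_Ici_self key,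
      ae_restrict_of_ae_restrict_of_subset Set.Ioi_subset_Ici_self hii,
      ae_restrict_mem measurableSet_Ioi] with t hkey hder ht
    have heq : (fun s => f (z s)) =ᶠ[𝓝 t] fun _ => f (z 0) := by
      filter_upwards [Ioi_mem_nhds ht] with s hs using hconst s hs
    exact hkey.2 (hder.1.unique ((hasDerivAt_const t (f (z 0))).congr_of_eventuallyEq heq))
  have hne_bot : (ae (volume.restrict (Set.Ioi (0 : ℝ)))).NeBot := by
    rw [ae_neBot, Ne, Measure.restrict_eq_zero]
    simp
  obtain ⟨t, ⟨_, hDt⟩, ht⟩ := (hstat.and (ae_restrict_mem measurableSet_Ioi)).exists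
  have ht0 : (0 : ℝ) < t := ht
  have hzt : z t = z 0 := by
    have hint : ∫ s in (0 : ℝ)..t, z' s = 0 := by
      rw [intervalIntegral.integral_of_le ht0.le]
      apply integral_eq_zero_of_ae
      filter_upwards [ae_restrict_of_ae_restrict_of_subset
        (Set.Ioc_subset_Ioi_self : Set.Ioc (0 : ℝ) t ⊆ Set.Ioi 0) hstat] with s hs using hs.1
    rw [← sub_eq_zero, (hiii 0 t le_rfl ht0.le).2, hint]
  exact h0 (hzt ▸ hDt)
end

section
/- Let n ≥ 1. Let {d_k} and {ξ_k} be bounded sequences in ℝⁿ, let {η_k} be positive reals with ∑_{k=0}^∞ η_k = ∞ and lim_{k→∞} η_k = 0, and suppose that for every T > 0, lim_{s→∞} sup_{s ≤ i ≤ Λ_η(λ_η(s)+T)} ‖∑_{k=s}^{i} η_k ξ_k‖ = 0. Given z₀ ∈ ℝⁿ, define z_{k+1} = z_k − η_k (d_k + ξ_k); let z : [0, ∞) → ℝⁿ be the piecewise linear interpolation z(t) = z_k + ((t − λ_η(k))/η_k)(z_{k+1} − z_k) for t ∈ [λ_η(k), λ_η(k+1)); let d : [0, ∞) → ℝⁿ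 be the piecewise constant function d(s) = d_k for s ∈ [λ_η(k), λ_η(k+1)); and for each t ≥ 0 define z_t(s) = z(t) − ∫_t^s d(u) du for s ≥ t. Then for every T > 0, lim_{t→∞} sup_{s ∈ [t, t+T]} ‖z(s) − z_t(s)‖ = 0. -/
open Filter Topology Metric MeasureTheory

/-- `λ_η(k) = ∑_{i=0}^{k−1} η_i` (with `λ_η(0) = 0`). -/
noncomputable def lamEta (η : ℕ → ℝ) (k : ℕ) : ℝ := ∑ i ∈ Finset.range k, η i

/-- `Λ_η(t) = sup {k ∈ ℕ : λ_η(k) ≤ t}`. -/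
noncomputable def LamEta (η : ℕ → ℝ) (t : ℝ) : ℕ := sSup {k : ℕ | lamEta η k ≤ t}

section Interpolation

variable {E : Type*} [NormedAddCommGroup E] {η : ℕ → ℝ}

lemma lamEta_succ (η : ℕ → ℝ) (k : ℕ) : lamEta η (k + 1) = lamEta η k + η k :=
  Finset.sum_range_succ _ _

lemma lamEta_strictMono (hη : ∀ k, 0 < η k) : StrictMono (lamEta η) :=
  strictMono_nat_of_lt_succ fun k => by rw [lamEta_succ]; linarith [hη k]

lemma bddAbove_setOf_lamEta_le (hdiv : Tendsto (lamEta η) atTop atTop) (t : ℝ) :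
    BddAbove {k : ℕ | lamEta η k ≤ t} := by
  obtain ⟨N, hN⟩ := eventually_atTop.1 (hdiv.eventually_gt_atTop t)
  refine ⟨N, fun k hk => ?_⟩
  by_contra! h
  exact (hN k h.le).not_ge hk

lemma le_LamEta (hdiv : Tendsto (lamEta η) atTop atTop) {t : ℝ} {k : ℕ}
    (hk : lamEta η k ≤ t) : k ≤ LamEta η t :=
  le_csSup (bddAbove_setOf_lamEta_le hdiv t) hk

lemma exists_mem_Ico_lamEta (hdiv : Tendsto (lamEta η) atTop atTop) {t : ℝ} {N : ℕ}
    (ht : lamEta η N ≤ t) : ∃ k, N ≤ k ∧ t ∈ Set.Ico (lamEta η k) (lamEta η (k + 1)) := by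
  refine ⟨LamEta η t, le_LamEta hdiv ht,
    Nat.sSup_mem ⟨N, ht⟩ (bddAbove_setOf_lamEta_le hdiv t), ?_⟩
  by_contra! h
  exact absurd (le_LamEta hdiv h) (by lia)

lemma le_biSup_Icc {f : ℕ → ℝ} (hf : ∀ i, 0 ≤ f i) {a b i : ℕ} (hi : i ∈ Set.Icc a b) :
    f i ≤ ⨆ j ∈ Set.Icc a b, f j := by
  have hbdd : BddAbove (Set.range fun j => ⨆ _ : j ∈ Set.Icc a b, f j) := by
    refine ⟨∑ j ∈ Finset.Icc a b, f j, ?_⟩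
    rintro _ ⟨j, rfl⟩
    refine Real.iSup_le (fun hj => ?_) (Finset.sum_nonneg fun j _ => hf j)
    exact Finset.single_le_sum (f := f) (fun j _ => hf j) (Finset.mem_Icc.2 hj)
  calc f i = ⨆ _ : i ∈ Set.Icc a b, f i := by rw [ciSup_pos hi]
    _ ≤ _ := le_ciSup hbdd i

lemma intervalIntegrable_of_eq_const_Ico {f : ℝ → E} {c : E} {a b x : ℝ}
    (hf : ∀ t ∈ Set.Ico a b, f t = c) (hx : x ∈ Set.Icc a b) :
    IntervalIntegrable f volume a x := by
  refine (intervalIntegrable_const (c := c)).congr_uIoo fun t ht => ?_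
  rw [Set.uIoo_of_le hx.1] at ht
  exact (hf t ⟨ht.1.le, ht.2.trans_le hx.2⟩).symm

variable [NormedSpace ℝ E]

lemma integral_of_eq_const_Ico [CompleteSpace E] {f : ℝ → E} {c : E} {a b x : ℝ}
    (hf : ∀ t ∈ Set.Ico a b, f t = c) (hx : x ∈ Set.Icc a b) :
    ∫ u in a..x, f u = (x - a) • c := by
  rw [← intervalIntegral.integral_const]
  refine intervalIntegral.integral_congr_uIoo fun t ht => ?_
  rw [Set.uIoo_of_le hx.1] at ht
  exact hf t ⟨ht.1.le, ht.2.trans_le hx.2⟩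

lemma integral_piecewise_const [CompleteSpace E] (hη : ∀ k, 0 < η k) {d : ℕ → E} {dc : ℝ → E}
    (hdc : ∀ k : ℕ, ∀ t ∈ Set.Ico (lamEta η k) (lamEta η (k + 1)), dc t = d k)
    {k : ℕ} {x : ℝ} (hx : x ∈ Set.Icc (lamEta η k) (lamEta η (k + 1))) :
    IntervalIntegrable dc volume 0 x ∧
      ∫ u in (0 : ℝ)..x, dc u
        = ∑ i ∈ Finset.range k, η i • d i + (x - lamEta η k) • d k := by
  induction k generalizing x with
  | zero =>
    have h0 : lamEta η 0 = 0 := Finset.sum_range_zero _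
    have hi := intervalIntegrable_of_eq_const_Ico (hdc 0) hx
    have he := integral_of_eq_const_Ico (hdc 0) hx
    rw [h0] at hi he
    simp [hi, he, h0]
  | succ k ih =>
    obtain ⟨h1, h2⟩ := ih (Set.right_mem_Icc.2 ((lamEta_strictMono hη).monotone k.le_succ))
    have hi := intervalIntegrable_of_eq_const_Ico (hdc (k + 1)) hx
    refine ⟨h1.trans hi, ?_⟩
    rw [← intervalIntegral.integral_add_adjacent_intervals h1 hi, h2,
      integral_of_eq_const_Ico (hdc (k + 1)) hx, Finset.sum_range_succ, lamEta_succ η k,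
      add_sub_cancel_left]

lemma iterate_eq_sub_sum {d ξ z : ℕ → E} (hz : ∀ k, z (k + 1) = z k - η k • (d k + ξ k))
    (k : ℕ) :
    z k = z 0 - ∑ i ∈ Finset.range k, η i • d i - ∑ i ∈ Finset.range k, η i • ξ i := by
  induction k with
  | zero => simp
  | succ k ih =>
    rw [hz, Finset.sum_range_succ, Finset.sum_range_succ, smul_add]
    nth_rewrite 1 [ih]
    abel

/-- On each step, the interpolation plus the integral of the direction equals the initial point
minus the interpolated accumulated noise. -/
lemma interpolation_add_integral [CompleteSpace E] (hη : ∀ k, 0 < η k) {d ξ z : ℕ → E}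
    (hz : ∀ k, z (k + 1) = z k - η k • (d k + ξ k)) {zc dc : ℝ → E}
    (hzc : ∀ k : ℕ, ∀ t ∈ Set.Ico (lamEta η k) (lamEta η (k + 1)),
      zc t = z k + ((t - lamEta η k) / η k) • (z (k + 1) - z k))
    (hdc : ∀ k : ℕ, ∀ t ∈ Set.Ico (lamEta η k) (lamEta η (k + 1)), dc t = d k)
    {k : ℕ} {t : ℝ} (ht : t ∈ Set.Ico (lamEta η k) (lamEta η (k + 1))) :
    zc t + ∫ u in (0 : ℝ)..t, dc u
      = z 0 - (∑ i ∈ Finset.range k, η i • ξ i + (t - lamEta η k) • ξ k) := by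
  rw [hzc k t ht, (integral_piecewise_const hη hdc (Set.Ico_subset_Icc_self ht)).2, hz k,
    sub_sub_cancel_left, smul_neg, smul_smul, div_mul_cancel₀ _ (hη k).ne', smul_add]
  nth_rewrite 1 [iterate_eq_sub_sum hz k]
  abel

end Interpolation

/-- The piecewise linear interpolation of the iterates
`z_{k+1} = z_k − η_k (d_k + ξ_k)` asymptotically tracks, uniformly on windows of length
`T`, the time-shifted solutions `z_t(s) = z(t) − ∫_t^s d(u) du` of the ODE driven by the
piecewise constant direction `d(·)`. -/
theorem stmt7 (n : ℕ) (hn : 1 ≤ n)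
    (d ξ : ℕ → EuclideanSpace ℝ (Fin n))
    (hdbd : Bornology.IsBounded (Set.range d))
    (hξbd : Bornology.IsBounded (Set.range ξ))
    (η : ℕ → ℝ) (hηpos : ∀ k, 0 < η k)
    (hdiv : Tendsto (fun m => ∑ k ∈ Finset.range m, η k) atTop atTop)
    (hη0 : Tendsto η atTop (nhds 0))
    (hnoise : ∀ T : ℝ, 0 < T →
      Tendsto (fun s : ℕ =>
          ⨆ i ∈ Set.Icc s (LamEta η (lamEta η s + T)),
            ‖∑ k ∈ Finset.Icc s i, η k • ξ k‖) atTop (nhds 0))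
    (z0 : EuclideanSpace ℝ (Fin n)) (z : ℕ → EuclideanSpace ℝ (Fin n))
    (hz0 : z 0 = z0)
    (hzrec : ∀ k, z (k + 1) = z k - η k • (d k + ξ k))
    (zc : ℝ → EuclideanSpace ℝ (Fin n))
    (hzc : ∀ k : ℕ, ∀ t ∈ Set.Ico (lamEta η k) (lamEta η (k + 1)),
      zc t = z k + ((t - lamEta η k) / η k) • (z (k + 1) - z k))
    (dc : ℝ → EuclideanSpace ℝ (Fin n))
    (hdc : ∀ k : ℕ, ∀ t ∈ Set.Ico (lamEta η k) (lamEta η (k + 1)), dc t = d k)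
    (zt : ℝ → ℝ → EuclideanSpace ℝ (Fin n))
    (hzt : ∀ t s : ℝ, t ≤ s → zt t s = zc t - ∫ u in t..s, dc u) :
    ∀ T : ℝ, 0 < T →
      Tendsto (fun t : ℝ => ⨆ s ∈ Set.Icc t (t + T), ‖zc s - zt t s‖)
        atTop (nhds 0) := by
  intro T hT
  have hlam : Tendsto (lamEta η) atTop atTop := hdiv
  have hmono := lamEta_strictMono hηpos
  obtain ⟨C, hC⟩ := hξbd.exists_norm_le
  replace hC : ∀ k, ‖ξ k‖ ≤ C := fun k => hC _ ⟨k, rfl⟩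
  have hC0 : 0 ≤ C := (norm_nonneg _).trans (hC 0)
  rw [Metric.tendsto_atTop]
  intro ε hε
  obtain ⟨δ, hδ, hδε⟩ : ∃ δ > 0, δ + 2 * C * δ < ε := by
    refine ⟨ε / (2 * (1 + 2 * C)), by positivity, ?_⟩
    have : ε / (2 * (1 + 2 * C)) + 2 * C * (ε / (2 * (1 + 2 * C))) = ε / 2 := by
      field_simp
    linarith
  obtain ⟨N, hN⟩ := eventually_atTop.1 ((hη0.eventually_lt_const (lt_min one_pos hδ)).and
    ((hnoise (T + 1) (by linarith)).eventually_lt_const hδ))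
  refine ⟨lamEta η N, fun t ht => ?_⟩
  have hnonneg : 0 ≤ ⨆ s ∈ Set.Icc t (t + T), ‖zc s - zt t s‖ :=
    Real.iSup_nonneg fun s => Real.iSup_nonneg fun _ => norm_nonneg _
  rw [Real.dist_0_eq_abs, abs_of_nonneg hnonneg]
  refine lt_of_le_of_lt ?_ hδε
  refine Real.iSup_le (fun s => Real.iSup_le (fun hs => ?_) (by positivity)) (by positivity)
  obtain ⟨k, hNk, hk⟩ := exists_mem_Ico_lamEta hlam ht
  obtain ⟨m, hkm, hm⟩ := exists_mem_Ico_lamEta hlam (hk.1.trans hs.1)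
  obtain ⟨hηk, hnk⟩ := hN k hNk
  obtain ⟨hηm, -⟩ := hN m (hNk.trans hkm)
  rw [lt_min_iff] at hηk hηm
  have hsum : ‖∑ i ∈ Finset.range m, η i • ξ i - ∑ i ∈ Finset.range k, η i • ξ i‖ ≤ δ := by
    rcases hkm.eq_or_lt with rfl | hlt
    · simpa using hδ.le
    obtain ⟨j, rfl⟩ : ∃ j, m = j + 1 := ⟨m - 1, by lia⟩
    have hj : j ∈ Set.Icc k (LamEta η (lamEta η k + (T + 1))) := by
      refine ⟨by lia, le_LamEta hlam ?_⟩
      have h1 := hmono.monotone j.le_succ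
      have h2 := hk.2
      rw [lamEta_succ] at h2
      linarith [hm.1, hs.2]
    rw [← Finset.sum_Ico_eq_sub _ hkm]
    exact (le_biSup_Icc (f := fun i => ‖∑ k ∈ Finset.Icc k i, η k • ξ k‖)
      (fun _ => norm_nonneg _) hj).trans hnk.le
  have hstep : ∀ {i : ℕ} {x : ℝ}, x ∈ Set.Ico (lamEta η i) (lamEta η (i + 1)) → η i < δ →
      ‖(x - lamEta η i) • ξ i‖ ≤ C * δ := by
    intro i x hx hi
    rw [lamEta_succ] at hx
    rw [norm_smul, Real.norm_of_nonneg (sub_nonneg.2 hx.1), mul_comm C]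
    exact mul_le_mul (by linarith [hx.2]) (hC i) (norm_nonneg _) hδ.le
  have key : zc s - zt t s = (t - lamEta η k) • ξ k - (s - lamEta η m) • ξ m
      - (∑ i ∈ Finset.range m, η i • ξ i - ∑ i ∈ Finset.range k, η i • ξ i) := by
    have hkt := interpolation_add_integral hηpos hzrec hzc hdc hk
    have hms := interpolation_add_integral hηpos hzrec hzc hdc hm
    rw [hzt t s hs.1, ← intervalIntegral.integral_interval_sub_left
      (integral_piecewise_const hηpos hdc (Set.Ico_subset_Icc_self hm)).1
      (integral_piecewise_const hηpos hdc (Set.Ico_subset_Icc_self hk)).1,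
      eq_sub_of_add_eq hkt, eq_sub_of_add_eq hms]
    abel
  rw [key]
  linarith [norm_sub_le ((t - lamEta η k) • ξ k - (s - lamEta η m) • ξ m)
      (∑ i ∈ Finset.range m, η i • ξ i - ∑ i ∈ Finset.range k, η i • ξ i),
    norm_sub_le ((t - lamEta η k) • ξ k) ((s - lamEta η m) • ξ m),
    hstep hk hηk.2, hstep hm hηm.2]
end

section
/- Let n ≥ 1. Let {z_k} be a bounded sequence in ℝⁿ with lim_{k→∞} ‖z_{k+1} − z_k‖ = 0, let {η_k} be positive reals with ∑_{k=0}^∞ η_k = ∞ and lim_{k→∞} η_k = 0, and let z : [0, ∞) → ℝⁿ be the piecewise linear interpolation z(t) = z_k + ((t − λ_η(k))/η_k)(z_{k+1} − z_k) for t ∈ [λ_η(k), λ_η(k+1)). Let g : ℝⁿ → ℝⁿ and Ψ : ℝⁿ → ℝ be continuous, and set x_k = g(z_k) and x(t) = g(z(t)). Then liminf_{t→∞} Ψ(x(t)) = liminf_{k→∞} Ψ(x_k) and limsup_{t→∞} Ψ(x(t)) = limsup_{k→∞} Ψ(x_k). -/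
open Filter Topology Metric

/-- Functions whose difference vanishes along a filter have the same limsup. -/
theorem limsup_eq_of_tendsto_sub {α : Type*} {f : Filter α} [f.NeBot] {u v : α → ℝ}
    (huv : Tendsto (fun a => u a - v a) f (𝓝 0))
    (hu : IsBoundedUnder (· ≤ ·) f u) (hu' : IsBoundedUnder (· ≥ ·) f u)
    (hv : IsBoundedUnder (· ≤ ·) f v) (hv' : IsBoundedUnder (· ≥ ·) f v) :
    limsup u f = limsup v f := by
  have key : ∀ {u v : α → ℝ}, Tendsto (fun a => u a - v a) f (𝓝 0) →
      IsBoundedUnder (· ≥ ·) f u →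
      IsBoundedUnder (· ≤ ·) f v → IsBoundedUnder (· ≥ ·) f v →
      limsup u f ≤ limsup v f := by
    intro u v h hu' hv hv'
    refine le_of_forall_pos_le_add fun ε hε => ?_
    rw [← limsup_add_const f v ε hv hv'.isCoboundedUnder_le]
    refine limsup_le_limsup ?_ hu'.isCoboundedUnder_le ?_
    · filter_upwards [h.eventually (gt_mem_nhds hε)] with a ha
      linarith
    · obtain ⟨b, hb⟩ := hv
      refine ⟨b + ε, ?_⟩
      rw [eventually_map] at hb ⊢
      filter_upwards [hb] with a ha
      linarith
  refine le_antisymm (key huv hu' hv hv') (key ?_ hv' hu hu')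
  simpa using huv.neg

/-- Functions whose difference vanishes along a filter have the same liminf. -/
theorem liminf_eq_of_tendsto_sub {α : Type*} {f : Filter α} [f.NeBot] {u v : α → ℝ}
    (huv : Tendsto (fun a => u a - v a) f (𝓝 0))
    (hu : IsBoundedUnder (· ≤ ·) f u) (hu' : IsBoundedUnder (· ≥ ·) f u)
    (hv : IsBoundedUnder (· ≤ ·) f v) (hv' : IsBoundedUnder (· ≥ ·) f v) :
    liminf u f = liminf v f := by
  have key : ∀ {u v : α → ℝ}, Tendsto (fun a => u a - v a) f (𝓝 0) →
      IsBoundedUnder (· ≤ ·) f u → IsBoundedUnder (· ≥ ·) f u →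
      IsBoundedUnder (· ≤ ·) f v →
      liminf u f ≤ liminf v f := by
    intro u v h hu hu' hv
    refine le_of_forall_pos_sub_le fun ε hε => ?_
    rw [sub_eq_add_neg, ← liminf_add_const f u (-ε) hu.isCoboundedUnder_ge hu']
    refine liminf_le_liminf ?_ ?_ hv.isCoboundedUnder_ge
    · filter_upwards [h.eventually (gt_mem_nhds hε)] with a ha
      linarith
    · obtain ⟨b, hb⟩ := hu'
      refine ⟨b + -ε, ?_⟩
      rw [eventually_map] at hb ⊢
      filter_upwards [hb] with a ha
      linarith
  refine le_antisymm (key huv hu hu' hv) (key ?_ hv hv' hu)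
  simpa using huv.neg

/-- Along a strictly increasing unbounded sequence `l`, every `t ≥ l 0` lies in some
`[l k, l (k + 1))`, and the choice of `k` carries `atTop` onto `atTop`. -/
theorem exists_index_of_strictMono {l : ℕ → ℝ} (hl : StrictMono l)
    (hlim : Tendsto l atTop atTop) :
    ∃ K : ℝ → ℕ, (∀ t, l 0 ≤ t → t ∈ Set.Ico (l (K t)) (l (K t + 1))) ∧
      map K atTop = atTop := by
  have hex : ∀ t, ∃ k, l 0 ≤ t → t ∈ Set.Ico (l k) (l (k + 1)) := by
    intro t
    by_cases ht : l 0 ≤ t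
    · have h : ∃ k, t < l k := (hlim.eventually_gt_atTop t).exists
      classical
      obtain ⟨k, hk⟩ : ∃ k, Nat.find h = k + 1 := by
        refine Nat.exists_eq_succ_of_ne_zero fun h0 => ?_
        have := Nat.find_spec h
        rw [h0] at this
        linarith
      refine ⟨k, fun _ => ⟨?_, hk ▸ Nat.find_spec h⟩⟩
      exact not_lt.mp (Nat.find_min h (by omega))
    · exact ⟨0, fun h => absurd h ht⟩
  choose K hK using hex
  refine ⟨K, hK, le_antisymm (tendsto_atTop.2 fun N => ?_) ?_⟩
  · filter_upwards [eventually_ge_atTop (l N)] with t ht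
    have h := (hK t ((hl.monotone N.zero_le).trans ht)).2
    exact Nat.lt_succ_iff.mp (hl.lt_iff_lt.mp (ht.trans_lt h))
  · have hid : K ∘ l = id := by
      funext k
      obtain ⟨h1, h2⟩ := hK (l k) (hl.monotone k.zero_le)
      exact le_antisymm (hl.le_iff_le.mp h1) (Nat.lt_succ_iff.mp (hl.lt_iff_lt.mp h2))
    calc (atTop : Filter ℕ) = map K (map l atTop) := by rw [map_map, hid, map_id]
      _ ≤ map K atTop := map_mono hlim

/-- For a bounded sequence `z_k` with vanishing successive gaps and its
piecewise linear interpolation `z(t)`, and continuous maps `g`, `Ψ`: the continuous-time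
liminf/limsup of `Ψ(g(z(t)))` coincide with the discrete liminf/limsup of
`Ψ(g(z_k))`. -/
theorem stmt8 (n : ℕ) (hn : 1 ≤ n)
    (z : ℕ → EuclideanSpace ℝ (Fin n))
    (hzbd : Bornology.IsBounded (Set.range z))
    (hgap : Tendsto (fun k => ‖z (k + 1) - z k‖) atTop (nhds 0))
    (η : ℕ → ℝ) (hηpos : ∀ k, 0 < η k)
    (hdiv : Tendsto (fun m => ∑ k ∈ Finset.range m, η k) atTop atTop)
    (hη0 : Tendsto η atTop (nhds 0))
    (zc : ℝ → EuclideanSpace ℝ (Fin n))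
    (hzc : ∀ k : ℕ, ∀ t ∈ Set.Ico (lamEta η k) (lamEta η (k + 1)),
      zc t = z k + ((t - lamEta η k) / η k) • (z (k + 1) - z k))
    (g : EuclideanSpace ℝ (Fin n) → EuclideanSpace ℝ (Fin n)) (hg : Continuous g)
    (Ψ : EuclideanSpace ℝ (Fin n) → ℝ) (hΨ : Continuous Ψ) :
    Filter.liminf (fun t : ℝ => Ψ (g (zc t))) atTop
        = Filter.liminf (fun k : ℕ => Ψ (g (z k))) atTop ∧
    Filter.limsup (fun t : ℝ => Ψ (g (zc t))) atTop
        = Filter.limsup (fun k : ℕ => Ψ (g (z k))) atTop := by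
  have hmono : StrictMono (lamEta η) := strictMono_nat_of_lt_succ fun k => by
    simpa [lamEta, Finset.sum_range_succ] using hηpos k
  obtain ⟨K, hK, hKmap⟩ := exists_index_of_strictMono hmono hdiv
  have hKlim : Tendsto K atTop atTop := hKmap.le
  have hF : Continuous fun x => Ψ (g x) := hΨ.comp hg
  have hcomp : IsCompact (closure (Set.range z)) := hzbd.isCompact_closure
  have hdist : Tendsto (fun t => dist (z (K t)) (zc t)) atTop (𝓝 0) := by
    refine squeeze_zero' (Eventually.of_forall fun _ => dist_nonneg) ?_ (hgap.comp hKlim)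
    filter_upwards [eventually_ge_atTop (lamEta η 0)] with t ht
    obtain ⟨h1, h2⟩ := hK t ht
    have h3 : lamEta η (K t + 1) = lamEta η (K t) + η (K t) := Finset.sum_range_succ _ _
    have hpos := hηpos (K t)
    rw [hzc _ t (hK t ht), dist_self_add_right, norm_smul, Real.norm_of_nonneg
      (div_nonneg (sub_nonneg.2 h1) hpos.le)]
    refine mul_le_of_le_one_left (norm_nonneg _) ((div_le_one hpos).2 ?_)
    linarith
  have hsub : Tendsto (fun t => Ψ (g (zc t)) - Ψ (g (z (K t)))) atTop (𝓝 0) := by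
    rw [Metric.tendsto_nhds]
    intro ε hε
    obtain ⟨δ, hδ, h⟩ := Metric.mem_uniformity_dist.1
      (hcomp.uniformContinuousAt_of_continuousAt _ (fun x _ => hF.continuousAt)
        (Metric.dist_mem_uniformity hε))
    filter_upwards [hdist.eventually (gt_mem_nhds hδ)] with t ht
    have h4 : dist (Ψ (g (z (K t)))) (Ψ (g (zc t))) < ε :=
      h ht (subset_closure (Set.mem_range_self _))
    rw [dist_comm] at h4
    simpa [Real.dist_eq] using h4
  obtain ⟨C, hC⟩ := (hcomp.image hF).isBounded.exists_norm_le
  have hCz : ∀ k, |Ψ (g (z k))| ≤ C := fun k =>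
    hC _ (Set.mem_image_of_mem _ (subset_closure (Set.mem_range_self k)))
  have hv : IsBoundedUnder (· ≤ ·) atTop fun t => Ψ (g (z (K t))) :=
    isBoundedUnder_of ⟨C, fun t => (abs_le.1 (hCz _)).2⟩
  have hv' : IsBoundedUnder (· ≥ ·) atTop fun t => Ψ (g (z (K t))) :=
    isBoundedUnder_of ⟨-C, fun t => (abs_le.1 (hCz _)).1⟩
  have hclose : ∀ᶠ t in atTop, |Ψ (g (zc t)) - Ψ (g (z (K t)))| < 1 := by
    simpa [Real.dist_eq] using Metric.tendsto_nhds.1 hsub 1 one_pos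
  have hu : IsBoundedUnder (· ≤ ·) atTop fun t => Ψ (g (zc t)) := by
    refine isBoundedUnder_of_eventually_le (a := C + 1) ?_
    filter_upwards [hclose] with t ht
    linarith [(abs_lt.1 ht).2, (abs_le.1 (hCz (K t))).2]
  have hu' : IsBoundedUnder (· ≥ ·) atTop fun t => Ψ (g (zc t)) := by
    refine isBoundedUnder_of_eventually_ge (a := -C - 1) ?_
    filter_upwards [hclose] with t ht
    linarith [(abs_lt.1 ht).1, (abs_le.1 (hCz (K t))).1]
  constructor
  · rw [liminf_eq_of_tendsto_sub hsub hu hu' hv hv']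
    conv_rhs => rw [← hKmap]
    rfl
  · rw [limsup_eq_of_tendsto_sub hsub hu hu' hv hv']
    conv_rhs => rw [← hKmap]
    rfl
end
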